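/- arXiv:2512.22835 — 2 statements merged into one kernel-verified Lean document; each statement's English description precedes it below -/
import Mathlib

section
/- Let k > ℓ ≥ 1 and n ≥ 1 be integers, let m ≥ 1 and λ be integers with 0 ≤ λ ≤ k+ℓ−3, and let p = (k+ℓ)m+2+λ be a prime. Then every (k,ℓ)-sum-free subset A of F_p^n satisfies |A| ≤ (m+1)·p^{n−1}. -/
open Pointwise

/-- `itSum h A` is the `h`-fold sumset `hA = A + ⋯ + A` (`h` copies), with `itSum 0 A = {0}`. -/
def itSum {G : Type*} [AddCommMonoid G] : ℕ → Set G → Set G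
  | 0, _ => {0}
  | h + 1, A => itSum h A + A

/-- `A` is `(k,ℓ)`-sum-free: the sumsets `kA` and `ℓA` are disjoint. -/
def KLFree {G : Type*} [AddCommMonoid G] (k l : ℕ) (A : Set G) : Prop :=
  itSum k A ∩ itSum l A = ∅

/-- The interval `[a, a+t] = {a, a+1, …, a+t}` in `ZMod p`. -/
def Ival {p : ℕ} (a : ZMod p) (t : ℕ) : Set (ZMod p) :=
  {x | ∃ i : ℕ, i ≤ t ∧ x = a + (i : ZMod p)}

/-- The cuboid `[a, a+t] × F_p^{n'}` inside the model space `F_p × F_p^{n'}`. -/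
def cub (p n' : ℕ) (a : ZMod p) (t : ℕ) : Set (ZMod p × (Fin n' → ZMod p)) :=
  {x | x.1 ∈ Ival a t}

/-- The element `a_j = -(km+1+j)·(k-ℓ)⁻¹` of `F_p`. -/
def ajElt (k l m p j : ℕ) : ZMod p :=
  -((k * m + 1 + j : ℕ) : ZMod p) * (((k - l : ℕ) : ZMod p))⁻¹

/-- The layer `A_i = (A - i·v) ∩ K` of `A` w.r.t. the decomposition `(v, K)`. -/
def layerKL {p n : ℕ} (v : Fin n → ZMod p) (K : Submodule (ZMod p) (Fin n → ZMod p))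
    (A : Set (Fin n → ZMod p)) (i : ZMod p) : Set (Fin n → ZMod p) :=
  {x | x ∈ K ∧ x + i • v ∈ A}

/-- The support `Supp(A) = {i | A_i ≠ ∅}` w.r.t. the decomposition `(v, K)`. -/
def supp {p n : ℕ} (v : Fin n → ZMod p) (K : Submodule (ZMod p) (Fin n → ZMod p))
    (A : Set (Fin n → ZMod p)) : Set (ZMod p) :=
  {i | (layerKL v K A i).Nonempty}

/-- The weight `ω(A) = |Supp(A)|` w.r.t. the decomposition `(v, K)`. -/
noncomputable def weight {p n : ℕ} (v : Fin n → ZMod p)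
    (K : Submodule (ZMod p) (Fin n → ZMod p)) (A : Set (Fin n → ZMod p)) : ℕ :=
  (supp v K A).ncard

/-- `A ⊆ F_p^n` is trivial: isomorphic to a subset of some extremal cuboid `A_{k,ℓ,p,j}`. -/
def IsTrivialKL (k l m lam p n : ℕ) (A : Set (Fin n → ZMod p)) : Prop :=
  ∃ (e : (Fin n → ZMod p) ≃+ (ZMod p × (Fin (n - 1) → ZMod p))) (j : ℕ),
    j < (lam + 2) / 2 ∧ e '' A ⊆ cub p (n - 1) (ajElt k l m p j) m

/-- Type 1. -/
def IsType1 (k l m lam p n : ℕ) (A : Set (Fin n → ZMod p)) : Prop :=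
  A.ncard = m * p ^ (n - 1) ∧
  ∃ (e : (Fin n → ZMod p) ≃+ (ZMod p × (Fin (n - 1) → ZMod p))) (a : ZMod p),
    ((l : ZMod p) * a - (k : ZMod p) * (a + (m : ZMod p) - 1) ∈ Ival (1 : ZMod p) (l - 1) ∨
      (lam + l + 2 ≤ k ∧
        (l : ZMod p) * a - (k : ZMod p) * (a + (m : ZMod p) - 1) ∈
          Ival ((lam + l + 2 : ℕ) : ZMod p) (k - (lam + l + 2)))) ∧
    e '' A = cub p (n - 1) a (m - 1)

/-- The element `a = m·k·(ℓ-k)⁻¹` of `F_p` used in type 2. -/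
def type2a (k l m p : ℕ) : ZMod p :=
  (m : ZMod p) * (k : ZMod p) * (((l : ZMod p) - (k : ZMod p))⁻¹)

/-- Type 2. -/
def IsType2 (k l m p n : ℕ) (A : Set (Fin n → ZMod p)) : Prop :=
  l = 1 ∧ 2 ≤ n ∧ A.ncard = m * p ^ (n - 1) ∧
  ∃ (e : (Fin n → ZMod p) ≃+ (ZMod p × (Fin (n - 1) → ZMod p)))
      (V : Submodule (ZMod p) (Fin (n - 1) → ZMod p)),
    V ≠ ⊤ ∧
    e '' A =
      ({type2a k l m p} ×ˢ (Set.univ \ (V : Set (Fin (n - 1) → ZMod p)))) ∪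
        ((Ival (type2a k l m p + 1) (m - 2)) ×ˢ (Set.univ : Set (Fin (n - 1) → ZMod p))) ∪
        ({type2a k l m p + (m : ZMod p)} ×ˢ (V : Set (Fin (n - 1) → ZMod p)))

/-- Normal: of type 1 or type 2. -/
def IsNormalKL (k l m lam p n : ℕ) (A : Set (Fin n → ZMod p)) : Prop :=
  IsType1 k l m lam p n A ∨ IsType2 k l m p n A

/-- The element `a = (ℓm+k-1)·(k-ℓ)⁻¹` of `F_p` used in type 3. -/
def type3a (k l m p : ℕ) : ZMod p :=
  ((l * m + k - 1 : ℕ) : ZMod p) * (((k - l : ℕ) : ZMod p))⁻¹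

/-- Type 3. -/
def IsType3 (k l m p n : ℕ) (A : Set (Fin n → ZMod p)) : Prop :=
  A.ncard = m * p ^ (n - 1) ∧
  ∃ e : (Fin n → ZMod p) ≃+ (ZMod p × (Fin (n - 1) → ZMod p)),
    e '' A = {x | x.1 ∈ Ival (type3a k l m p - 1) (m + 1) \
      {type3a k l m p, type3a k l m p + (m : ZMod p) - 1}}

/-- Type 4 (for `p = 5m+3`). -/
def IsType4 (m p n : ℕ) (A : Set (Fin n → ZMod p)) : Prop :=
  2 ≤ n ∧ A.ncard = m * p ^ (n - 1) ∧
  ∃ (e : (Fin n → ZMod p) ≃+ (ZMod p × (Fin (n - 1) → ZMod p)))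
      (V : Submodule (ZMod p) (Fin (n - 1) → ZMod p)),
    V ≠ ⊤ ∧
    e '' A =
      (({((2 * m + 1 : ℕ) : ZMod p), ((3 * m + 2 : ℕ) : ZMod p)} : Set (ZMod p)) ×ˢ
          (V : Set (Fin (n - 1) → ZMod p))) ∪
        (({((2 * m + 2 : ℕ) : ZMod p), ((3 * m + 1 : ℕ) : ZMod p)} : Set (ZMod p)) ×ˢ
          (Set.univ \ (V : Set (Fin (n - 1) → ZMod p)))) ∪
        ((Ival ((2 * m + 3 : ℕ) : ZMod p) (m - 3)) ×ˢ (Set.univ : Set (Fin (n - 1) → ZMod p)))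

/-- The set `A₀ ⊆ F_p × F_p^s` used in type 5 (for `p = 4m+3`), with `a = (m+2)/2`. -/
def type5A0 (m p s : ℕ) (P : Set (Fin s → ZMod p)) : Set (ZMod p × (Fin s → ZMod p)) :=
  {(((m + 2 : ℕ) : ZMod p) * (2 : ZMod p)⁻¹ - 1, (0 : Fin s → ZMod p))} ∪
    ({((m + 2 : ℕ) : ZMod p) * (2 : ZMod p)⁻¹} ×ˢ (Set.univ \ P)) ∪
    ((Ival (((m + 2 : ℕ) : ZMod p) * (2 : ZMod p)⁻¹ + 1) (m - 3)) ×ˢ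
      (Set.univ : Set (Fin s → ZMod p))) ∪
    ({((m + 2 : ℕ) : ZMod p) * (2 : ZMod p)⁻¹ + (m : ZMod p) - 1} ×ˢ
      (Set.univ \ {(0 : Fin s → ZMod p)})) ∪
    ({((m + 2 : ℕ) : ZMod p) * (2 : ZMod p)⁻¹ + (m : ZMod p)} ×ˢ P)

/-- Type 5 (for `p = 4m+3`). -/
def IsType5 (m p n : ℕ) (A : Set (Fin n → ZMod p)) : Prop :=
  A.ncard = m * p ^ (n - 1) ∧
  ∃ s : ℕ, s ≤ n - 1 ∧
    ∃ (e : (Fin n → ZMod p) ≃+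
          (ZMod p × (Fin s → ZMod p) × (Fin (n - 1 - s) → ZMod p)))
      (P : Set (Fin s → ZMod p)),
      P.Nonempty ∧ (0 : Fin s → ZMod p) ∉ itSum 3 P ∧
      e '' A = {x | (x.1, x.2.1) ∈ type5A0 m p s P}

/-- `τ` is feasible for `c`. -/
def Feasible (c τ : ℝ) : Prop :=
  ∀ q : ℕ, q.Prime → ∀ B : Set (ZMod q),
    (B.ncard : ℝ) ≤ c * q →
    ((B + B).ncard : ℝ) ≤ (2 + τ) * (B.ncard : ℝ) - 3 →
    ∃ y d : ZMod q, d ≠ 0 ∧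
      B ⊆ {x | ∃ i : ℕ, i ≤ (B + B).ncard - B.ncard ∧ x = y + (i : ZMod q) * d}

section Kneser

open Finset

variable {G : Type*} [AddCommGroup G] [Fintype G]

/-- The map `(a, b) ↦ x + a + b` on `H₁ × H₂` has fibres of size at most `|H₁ ⊓ H₂|`. -/
lemma card_mul_card_le_of_add_mem [DecidableEq G] (H₁ H₂ : AddSubgroup G) (V X T : Finset G) (x : G)
    (hV : ∀ a ∈ V, a ∈ H₁) (hX : ∀ b ∈ X, b ∈ H₂)
    (hT : ∀ a ∈ V, ∀ b ∈ X, x + a + b ∈ T) :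
    V.card * X.card ≤ Nat.card (H₁ ⊓ H₂ : AddSubgroup G) * T.card := by
  rw [← card_product]
  refine card_le_mul_card_image_of_maps_to (f := fun q : G × G ↦ x + q.1 + q.2) ?_ _ ?_
  · intro q hq
    rw [mem_product] at hq
    exact hT _ hq.1 _ hq.2
  · intro t _
    rcases (filter (fun q : G × G ↦ x + q.1 + q.2 = t) (V ×ˢ X)).eq_empty_or_nonempty with
      h | ⟨q₀, hq₀⟩
    · simp [h]
    · classical
      have hcard : Nat.card (H₁ ⊓ H₂ : AddSubgroup G)
          = (univ.filter (fun g ↦ g ∈ H₁ ⊓ H₂)).card := by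
        rw [Nat.card_eq_fintype_card, Fintype.card_subtype]
      rw [hcard]
      simp only [mem_filter, mem_product] at hq₀
      refine card_le_card_of_injOn (fun q ↦ q.1 - q₀.1) ?_ ?_
      · intro q hq
        simp only [coe_filter, mem_product, Set.mem_ofPred_eq] at hq
        simp only [coe_filter, mem_univ, true_and, Set.mem_ofPred_eq]
        refine ⟨H₁.sub_mem (hV _ hq.1.1) (hV _ hq₀.1.1), ?_⟩
        have h : q.1 - q₀.1 = q₀.2 - q.2 := by
          have h' : x + q.1 + q.2 = x + q₀.1 + q₀.2 := hq.2.trans hq₀.2.symm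
          rw [sub_eq_sub_iff_add_eq_add]
          rw [add_assoc, add_assoc] at h'
          rw [add_left_cancel h', add_comm]
        change q.1 - q₀.1 ∈ H₂
        rw [h]
        exact H₂.sub_mem (hX _ hq₀.1.2) (hX _ hq.1.2)
      · intro q hq r hr h
        simp only [coe_filter, mem_product, Set.mem_ofPred_eq] at hq hr
        have h₁ : q.1 = r.1 := sub_left_injective h
        have h₂ := hq.2.trans hr.2.symm
        rw [h₁] at h₂
        exact Prod.ext h₁ (add_left_cancel h₂)

lemma card_le_of_add_mem (H : AddSubgroup G) (V : Finset G)
    (hV : ∀ a ∈ V, ∀ g ∈ H, a + g ∈ V) (hne : V.Nonempty) : Nat.card H ≤ V.card := by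
  classical
  obtain ⟨a, ha⟩ := hne
  rw [Nat.card_eq_fintype_card, Fintype.card_subtype]
  refine card_le_card_of_injOn (fun g ↦ a + g) ?_ (add_right_injective a).injOn
  intro g hg
  exact hV a ha g (by simpa using hg)

/-- The asymmetric half of the union lemma. -/
lemma card_lt_card_of_mem_sdiff [DecidableEq G] (H₁ H₂ : AddSubgroup G) (C₁ C₂ : Finset G)
    (h₁ : ∀ c ∈ C₁, ∀ g ∈ H₁, c + g ∈ C₁) (h₂ : ∀ c ∈ C₂, ∀ g ∈ H₂, c + g ∈ C₂)
    (e₁ : (C₂ \ C₁).card + Nat.card (H₁ ⊓ H₂ : AddSubgroup G) < Nat.card H₁)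
    (e₂ : (C₁ \ C₂).card + Nat.card (H₁ ⊓ H₂ : AddSubgroup G) < Nat.card H₂)
    {x : G} (hx : x ∈ C₂ \ C₁) : Nat.card H₂ < Nat.card H₁ := by
  classical
  have i₁ : ∀ c, ∀ g ∈ H₁, (c + g ∈ C₁ ↔ c ∈ C₁) := fun c g hg ↦
    ⟨fun h ↦ by simpa using h₁ _ h (-g) (H₁.neg_mem hg), fun h ↦ h₁ _ h g hg⟩
  have i₂ : ∀ c, ∀ g ∈ H₂, (c + g ∈ C₂ ↔ c ∈ C₂) := fun c g hg ↦
    ⟨fun h ↦ by simpa using h₂ _ h (-g) (H₂.neg_mem hg), fun h ↦ h₂ _ h g hg⟩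
  have j₁ : ∀ a ∈ H₁, ∀ b, (x + a + b ∈ C₁ ↔ x + b ∈ C₁) := fun a ha b ↦ by
    rw [add_right_comm, i₁ _ a ha]
  rw [mem_sdiff] at hx
  set h := Nat.card (H₁ ⊓ H₂ : AddSubgroup G) with hh
  set V := univ.filter (fun a ↦ a ∈ H₁ ∧ x + a ∈ C₂) with hVdef
  set Y := univ.filter (fun a ↦ a ∈ H₁ ∧ x + a ∉ C₂) with hYdef
  set U := univ.filter (fun b ↦ b ∈ H₂ ∧ x + b ∈ C₁) with hUdef
  set X := univ.filter (fun b ↦ b ∈ H₂ ∧ x + b ∉ C₁) with hXdef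
  have hVY : V.card + Y.card = Nat.card H₁ := by
    rw [Nat.card_eq_fintype_card, Fintype.card_subtype, hVdef, hYdef, ← filter_filter,
      ← filter_filter, card_filter_add_card_filter_not]
  have hUX : U.card + X.card = Nat.card H₂ := by
    rw [Nat.card_eq_fintype_card, Fintype.card_subtype, hUdef, hXdef, ← filter_filter,
      ← filter_filter, card_filter_add_card_filter_not]
  have hVX : V.card * X.card ≤ h * (C₂ \ C₁).card := by
    refine card_mul_card_le_of_add_mem H₁ H₂ V X _ x (fun a ha ↦ ?_) (fun b hb ↦ ?_)
      (fun a ha b hb ↦ ?_)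
    · exact (mem_filter.1 ha).2.1
    · exact (mem_filter.1 hb).2.1
    · obtain ⟨ha, ha'⟩ := (mem_filter.1 ha).2
      obtain ⟨hb, hb'⟩ := (mem_filter.1 hb).2
      rw [mem_sdiff, i₂ _ b hb, j₁ a ha]
      exact ⟨ha', hb'⟩
  have hYU : Y.card * U.card ≤ h * (C₁ \ C₂).card := by
    refine card_mul_card_le_of_add_mem H₁ H₂ Y U _ x (fun a ha ↦ ?_) (fun b hb ↦ ?_)
      (fun a ha b hb ↦ ?_)
    · exact (mem_filter.1 ha).2.1
    · exact (mem_filter.1 hb).2.1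
    · obtain ⟨ha, ha'⟩ := (mem_filter.1 ha).2
      obtain ⟨hb, hb'⟩ := (mem_filter.1 hb).2
      rw [mem_sdiff, i₂ _ b hb, j₁ a ha]
      exact ⟨hb', ha'⟩
  have big : ∀ W : Finset G, (∀ a ∈ W, ∀ g ∈ H₁ ⊓ H₂, a + g ∈ W) → W.Nonempty → h ≤ W.card :=
    fun W ↦ card_le_of_add_mem (H₁ ⊓ H₂) W
  have hV : h ≤ V.card := by
    refine big V (fun a ha g hg ↦ ?_) ⟨0, ?_⟩
    · obtain ⟨ha, ha'⟩ := (mem_filter.1 ha).2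
      refine mem_filter.2 ⟨mem_univ _, H₁.add_mem ha hg.1, ?_⟩
      rwa [← add_assoc, i₂ _ g hg.2]
    · exact mem_filter.2 ⟨mem_univ _, H₁.zero_mem, by simpa using hx.1⟩
  have hX : h ≤ X.card := by
    refine big X (fun a ha g hg ↦ ?_) ⟨0, ?_⟩
    · obtain ⟨ha, ha'⟩ := (mem_filter.1 ha).2
      refine mem_filter.2 ⟨mem_univ _, H₂.add_mem ha hg.2, ?_⟩
      rwa [← add_assoc, i₁ _ g hg.1]
    · exact mem_filter.2 ⟨mem_univ _, H₂.zero_mem, by simpa using hx.2⟩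
  have hY : Y.card = 0 ∨ h ≤ Y.card := by
    rcases Y.eq_empty_or_nonempty with h0 | h0
    · exact Or.inl (by rw [h0, card_empty])
    · refine Or.inr (big Y (fun a ha g hg ↦ ?_) h0)
      obtain ⟨ha, ha'⟩ := (mem_filter.1 ha).2
      refine mem_filter.2 ⟨mem_univ _, H₁.add_mem ha hg.1, ?_⟩
      rwa [← add_assoc, i₂ _ g hg.2]
  have hU : U.card = 0 ∨ h ≤ U.card := by
    rcases U.eq_empty_or_nonempty with h0 | h0
    · exact Or.inl (by rw [h0, card_empty])
    · refine Or.inr (big U (fun a ha g hg ↦ ?_) h0)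
      obtain ⟨ha, ha'⟩ := (mem_filter.1 ha).2
      refine mem_filter.2 ⟨mem_univ _, H₂.add_mem ha hg.2, ?_⟩
      rwa [← add_assoc, i₁ _ g hg.1]
  have hpos : 0 < h := Nat.card_pos
  clear_value h V Y U X
  rcases hU with hU | hU
  · have : X.card ≤ (C₂ \ C₁).card := by
      refine Nat.le_of_mul_le_mul_left ?_ hpos
      exact (Nat.mul_le_mul_right _ hV).trans hVX
    omega
  · rcases hY with hY | hY
    · have : V.card ≤ (C₂ \ C₁).card := by
        refine Nat.le_of_mul_le_mul_left ?_ hpos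
        refine le_trans ?_ hVX
        rw [mul_comm]
        exact Nat.mul_le_mul_left _ hX
      omega
    · exfalso
      have key : ∀ s t e : ℕ, h ≤ s → h ≤ t → s * t ≤ h * e → s + t ≤ e + h := by
        intro s t e hs ht hst
        obtain ⟨s, rfl⟩ := Nat.exists_eq_add_of_le hs
        obtain ⟨t, rfl⟩ := Nat.exists_eq_add_of_le ht
        have : h * (h + s + t) ≤ h * e := by nlinarith [Nat.zero_le (s * t)]
        have := Nat.le_of_mul_le_mul_left this hpos
        omega
      have k₁ := key _ _ _ hV hX hVX
      have k₂ := key _ _ _ hY hU hYU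
      omega

/-- `C` is a union of cosets of a subgroup `H` with `N ≤ |C| + |H|`. -/
def HasLargePeriod (N : ℕ) (C : Finset G) : Prop :=
  ∃ H : AddSubgroup G, (∀ c ∈ C, ∀ g ∈ H, c + g ∈ C) ∧ N ≤ C.card + Nat.card H

lemma HasLargePeriod.union [DecidableEq G] {N : ℕ} {C₁ C₂ : Finset G} (hC₁ : HasLargePeriod N C₁)
    (hC₂ : HasLargePeriod N C₂) : HasLargePeriod N (C₁ ∪ C₂) := by
  by_cases h₁₂ : C₁ ⊆ C₂
  · rwa [union_eq_right.2 h₁₂]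
  by_cases h₂₁ : C₂ ⊆ C₁
  · rwa [union_eq_left.2 h₂₁]
  obtain ⟨H₁, s₁, n₁⟩ := hC₁
  obtain ⟨H₂, s₂, n₂⟩ := hC₂
  refine ⟨H₁ ⊓ H₂, fun c hc g hg ↦ ?_, ?_⟩
  · rcases mem_union.1 hc with hc | hc
    · exact mem_union_left _ (s₁ c hc g hg.1)
    · exact mem_union_right _ (s₂ c hc g hg.2)
  by_contra! hlt
  obtain ⟨y, hy⟩ := sdiff_nonempty.2 h₁₂
  obtain ⟨x, hx⟩ := sdiff_nonempty.2 h₂₁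
  have c₁ : (C₁ ∪ C₂).card = C₁.card + (C₂ \ C₁).card := by
    rw [← union_sdiff_self_eq_union, card_union_of_disjoint disjoint_sdiff]
  have c₂ : (C₁ ∪ C₂).card = C₂.card + (C₁ \ C₂).card := by
    rw [union_comm, ← union_sdiff_self_eq_union, card_union_of_disjoint disjoint_sdiff]
  have a := card_lt_card_of_mem_sdiff H₁ H₂ C₁ C₂ s₁ s₂ (by omega) (by omega) hx
  have b := card_lt_card_of_mem_sdiff H₂ H₁ C₂ C₁ s₂ s₁ (by rw [inf_comm]; omega)
    (by rw [inf_comm]; omega) hy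
  omega

lemma exists_hasLargePeriod_mem [DecidableEq G] (A B : Finset G) {a₀ b₀ : G}
    (ha₀ : a₀ ∈ A) (hb₀ : b₀ ∈ B) :
    ∃ C ⊆ A + B, a₀ + b₀ ∈ C ∧ HasLargePeriod (A.card + B.card) C := by
  classical
  obtain ⟨⟨A', B'⟩, hmem, hmax⟩ := exists_max_image
    (univ.filter (fun q : Finset G × Finset G ↦
      a₀ ∈ q.1 ∧ b₀ ∈ q.2 ∧ q.1 + q.2 ⊆ A + B ∧ q.1.card + q.2.card = A.card + B.card))
    (fun q ↦ q.1.card) ⟨(A, B), by simp [ha₀, hb₀]⟩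
  simp only [mem_filter, mem_univ, true_and] at hmem hmax
  obtain ⟨ha, hb, hsub, hcard⟩ := hmem
  have hadd : ∀ a ∈ A', ∀ b ∈ B', (b - b₀) + a ∈ A' := by
    intro a haA b hbB
    have hle := hmax (addDysonETransform (a - b₀) (A', B')) ⟨?_, ?_, ?_, ?_⟩
    · have heq : A' = A' ∪ ((a - b₀) +ᵥ B') := eq_of_subset_of_card_le subset_union_left hle
      rw [heq]
      refine mem_union_right _ (mem_vadd_finset.2 ⟨b, hbB, ?_⟩)
      rw [vadd_eq_add]; abel
    · exact mem_union_left _ ha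
    · refine mem_inter.2 ⟨hb, mem_vadd_finset.2 ⟨a, haA, ?_⟩⟩
      rw [vadd_eq_add]; abel
    · exact (addDysonETransform.subset _ _).trans hsub
    · exact (addDysonETransform.card _ _).trans hcard
  refine ⟨b₀ +ᵥ A', ?_, ?_, AddAction.stabilizer G A', ?_, ?_⟩
  · intro c hc
    obtain ⟨a, haA, rfl⟩ := mem_vadd_finset.1 hc
    rw [vadd_eq_add, add_comm b₀]
    exact hsub (add_mem_add haA hb)
  · exact mem_vadd_finset.2 ⟨a₀, ha, by rw [vadd_eq_add, add_comm]⟩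
  · intro c hc g hg
    obtain ⟨a, haA, rfl⟩ := mem_vadd_finset.1 hc
    have hg' : g +ᵥ A' = A' := hg
    refine mem_vadd_finset.2 ⟨g + a, ?_, ?_⟩
    · rw [← hg']
      exact mem_vadd_finset.2 ⟨a, haA, rfl⟩
    · simp only [vadd_eq_add]; abel
  · rw [card_vadd_finset, ← hcard, Nat.card_eq_fintype_card, Fintype.card_subtype]
    refine Nat.add_le_add_left ?_ _
    refine card_le_card_of_injOn (fun b ↦ b - b₀) (fun b hbB ↦ ?_) sub_left_injective.injOn
    refine mem_coe.2 (mem_filter.2 ⟨mem_univ _, AddAction.mem_stabilizer_iff.2 ?_⟩)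
    refine eq_of_subset_of_card_le (fun c hc ↦ ?_) (card_vadd_finset _ _).ge
    obtain ⟨a, haA, rfl⟩ := mem_vadd_finset.1 hc
    exact hadd a haA b hbB

/-- **Kneser's addition theorem**, for some period of the sumset. -/
lemma hasLargePeriod_add [DecidableEq G] (A B : Finset G) (hA : A.Nonempty) (hB : B.Nonempty) :
    HasLargePeriod (A.card + B.card) (A + B) := by
  classical
  have hex : ∀ s ∈ A + B, ∃ C ⊆ A + B, s ∈ C ∧ HasLargePeriod (A.card + B.card) C := by
    intro s hs
    obtain ⟨a, ha, b, hb, rfl⟩ := mem_add.1 hs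
    exact exists_hasLargePeriod_mem A B ha hb
  obtain ⟨s₀, hs₀⟩ := hA.add hB
  obtain ⟨C₀, hC₀, _, hP₀⟩ := hex s₀ hs₀
  obtain ⟨C, hC, hmax⟩ := exists_max_image
    (univ.filter (fun C ↦ C ⊆ A + B ∧ HasLargePeriod (A.card + B.card) C)) card
    ⟨C₀, by simp [hC₀, hP₀]⟩
  simp only [mem_filter, mem_univ, true_and] at hC hmax
  suffices h : A + B ⊆ C by rw [← h.antisymm' hC.1]; exact hC.2
  intro s hs
  obtain ⟨D, hD, hsD, hPD⟩ := hex s hs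
  have hle := hmax (C ∪ D) ⟨union_subset hC.1 hD, hC.2.union hPD⟩
  rw [eq_of_subset_of_card_le subset_union_left hle]
  exact mem_union_right _ hsD

end Kneser

section Stabilizer

variable {G : Type*} [AddCommGroup G]

/-- **Kneser's addition theorem**. -/
lemma ncard_add_ncard_le [Finite G] (A B : Set G) (hA : A.Nonempty) (hB : B.Nonempty) :
    A.ncard + B.ncard ≤ (A + B).ncard + Nat.card (AddAction.stabilizer G (A + B)) := by
  classical
  have := Fintype.ofFinite G
  obtain ⟨H, hH, hN⟩ := hasLargePeriod_add A.toFinset B.toFinset (by simpa) (by simpa)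
  rw [← Set.toFinset_add] at hH hN
  simp only [Set.mem_toFinset] at hH
  simp only [← Set.ncard_eq_toFinset_card'] at hN
  refine hN.trans (Nat.add_le_add_left ?_ _)
  refine AddSubgroup.card_le_of_le fun g hg ↦ ?_
  refine AddAction.mem_stabilizer_iff.2 (Set.eq_of_subset_of_ncard_le ?_ ?_ (Set.toFinite _))
  · rintro _ ⟨c, hc, rfl⟩
    change g + c ∈ A + B
    rw [add_comm g]
    exact hH c hc g hg
  · rw [Set.ncard_vadd_set]

lemma stabilizer_le_stabilizer_add (A B : Set G) :
    AddAction.stabilizer G A ≤ AddAction.stabilizer G (A + B) := by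
  intro g hg
  rw [AddAction.mem_stabilizer_iff] at hg ⊢
  rw [← vadd_add_assoc, hg]

lemma itSum_nonempty {A : Set G} (hA : A.Nonempty) (h : ℕ) : (itSum h A).Nonempty := by
  induction h with
  | zero => exact ⟨0, rfl⟩
  | succ h ih => exact ih.add hA

/-- Iterated form of Kneser's theorem. -/
lemma le_ncard_add_itSum [Finite G] {S A : Set G} (hS : S.Nonempty) (hA : A.Nonempty) {j N : ℕ}
    (hN : N ≤ S.ncard + j * Nat.card (AddAction.stabilizer G S)) (h : ℕ) :
    N + h * A.ncard ≤ (S + itSum h A).ncard +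
      (j + h) * Nat.card (AddAction.stabilizer G (S + itSum h A)) := by
  induction h with
  | zero =>
    have : S + itSum 0 A = S := by
      change S + {0} = S
      simp
    rw [this]
    simpa using hN
  | succ h ih =>
    change _ ≤ (S + (itSum h A + A)).ncard +
      _ * Nat.card (AddAction.stabilizer G (S + (itSum h A + A)))
    rw [← add_assoc S]
    set T := S + itSum h A
    have hk := ncard_add_ncard_le T A (hS.add (itSum_nonempty hA h)) hA
    have hc := AddSubgroup.card_le_of_le (stabilizer_le_stabilizer_add T A)
    have := Nat.mul_le_mul_left (j + h) hc
    linarith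

lemma image_itSum {G' : Type*} [AddCommGroup G'] (f : G →+ G') (A : Set G) (h : ℕ) :
    itSum h (f '' A) = f '' itSum h A := by
  induction h with
  | zero => simp [itSum]
  | succ h ih => simp only [itSum, ih, Set.image_add]

lemma itSum_neg (A : Set G) (h : ℕ) : itSum h (-A) = -itSum h A := by
  have := image_itSum (negAddMonoidHom : G →+ G) A h
  simpa using this

lemma itSum_succ_left (A : Set G) (h : ℕ) : itSum (h + 1) A = A + itSum h A :=
  add_comm _ _

end Stabilizer

/-- If `K = k + l`, `p < K (m + 1)` and `|G|` is a power of the prime `p`, then a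
`(k,l)`-sum-free subset of `G` has density at most `(m + 1) / p`. -/
lemma mul_ncard_le_of_klFree {k l m p : ℕ} (hk : 1 ≤ k) (hpp : p.Prime)
    (hpK : p < (k + l) * (m + 1)) (n : ℕ) : ∀ {G : Type} [AddCommGroup G] [Finite G],
    Nat.card G = p ^ n → ∀ A : Set G, KLFree k l A → p * A.ncard ≤ (m + 1) * p ^ n := by
  induction n using Nat.strong_induction_on with
  | _ n ih =>
  intro G _ _ hG A hfree
  rcases A.eq_empty_or_nonempty with rfl | hA
  · simp
  obtain ⟨k, rfl⟩ := Nat.exists_eq_add_of_le' hk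
  set S := A + itSum k A + itSum l (-A) with hS
  have hS' : S = itSum (k + 1) A - itSum l A := by
    rw [hS, itSum_neg, itSum_succ_left, sub_eq_add_neg]
  have hzero : (0 : G) ∉ S := by
    rw [hS']
    rintro ⟨a, ha, b, hb, hab⟩
    have hab' : a = b := sub_eq_zero.1 hab
    subst hab'
    exact (Set.mem_empty_iff_false a).1 (hfree ▸ ⟨ha, hb⟩)
  set H := AddAction.stabilizer G S with hH
  have hdisj : ∀ g ∈ H, g ∉ S := by
    intro g hg hgS
    have hneg : -g +ᵥ S = S := AddAction.mem_stabilizer_iff.1 (H.neg_mem hg)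
    apply hzero
    rw [← hneg]
    exact ⟨g, hgS, by simp⟩
  by_cases hbot : Nat.card H = 1
  · have h₁ := le_ncard_add_itSum hA hA (j := 0) (N := A.ncard) (by simp) k
    have h₂ := le_ncard_add_itSum (hA.add (itSum_nonempty hA k)) hA.neg h₁ l
    rw [← hS, ← hH, hbot, Set.ncard_neg] at h₂
    have h₃ : S.ncard < p ^ n := by
      rw [← hG, ← Set.ncard_univ]
      exact Set.ncard_lt_ncard (Set.ssubset_univ_iff.2 fun h ↦ hzero (h ▸ Set.mem_univ _))
    have h₄ : (k + 1 + l) * A.ncard + 2 ≤ p ^ n + (k + 1 + l) := by nlinarith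
    rcases n with _ | n
    · have : 0 < A.ncard := hA.ncard_pos
      nlinarith
    · rw [pow_succ] at h₄ ⊢
      suffices A.ncard ≤ (m + 1) * p ^ n by nlinarith
      by_contra! hlt
      have := Nat.mul_le_mul_left (k + 1 + l) (Nat.succ_le_of_lt hlt)
      have := Nat.mul_le_mul_left (p ^ n) hpK.le
      nlinarith
  · obtain ⟨r, hr, hHr⟩ := (Nat.dvd_prime_pow hpp).1 (hG ▸ H.card_addSubgroup_dvd_card)
    have hquot : Nat.card (G ⧸ H) * p ^ r = p ^ n := by
      rw [← hHr, ← hG]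
      exact H.card_eq_card_quotient_mul_card_addSubgroup.symm
    have hr0 : r ≠ 0 := by
      rintro rfl
      exact hbot (by simpa using hHr)
    have hcq : Nat.card (G ⧸ H) = p ^ (n - r) := by
      refine Nat.eq_of_mul_eq_mul_right (pow_pos hpp.pos r) ?_
      rw [hquot, ← pow_add, Nat.sub_add_cancel hr]
    have hfree' : KLFree (k + 1) l (QuotientAddGroup.mk' H '' A) := by
      refine Set.eq_empty_iff_forall_notMem.2 ?_
      rintro _ ⟨h₁, h₂⟩
      rw [image_itSum] at h₁ h₂
      obtain ⟨a, ha, rfl⟩ := h₁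
      obtain ⟨b, hb, hab⟩ := h₂
      refine hdisj (a - b) ?_ (hS' ▸ Set.sub_mem_sub ha hb)
      rw [sub_eq_add_neg, add_comm]
      exact QuotientAddGroup.eq.1 hab
    have hih := ih (n - r) (by omega) hcq _ hfree'
    have hle : A.ncard ≤ p ^ r * (QuotientAddGroup.mk' H '' A).ncard := by
      classical
      have := Fintype.ofFinite G
      have := Fintype.ofFinite (G ⧸ H)
      rw [Set.ncard_eq_toFinset_card', Set.ncard_eq_toFinset_card']
      refine Finset.card_le_mul_card_image_of_maps_to (f := QuotientAddGroup.mk' H)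
        (fun a ha ↦ ?_) _ (fun q _ ↦ ?_)
      · rw [Set.mem_toFinset] at ha ⊢
        exact ⟨a, ha, rfl⟩
      · obtain ⟨g, rfl⟩ := QuotientAddGroup.mk'_surjective H q
        rw [← hHr, Nat.card_eq_fintype_card, Fintype.card_subtype]
        refine Finset.card_le_card_of_injOn (fun a ↦ -g + a) (fun a ha ↦ ?_)
          (add_right_injective _).injOn
        refine Finset.mem_coe.2 (Finset.mem_filter.2 ⟨Finset.mem_univ _, ?_⟩)
        exact QuotientAddGroup.eq.1 (Finset.mem_filter.1 (Finset.mem_coe.1 ha)).2.symm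
    calc p * A.ncard ≤ p * (p ^ r * (QuotientAddGroup.mk' H '' A).ncard) :=
          Nat.mul_le_mul_left _ hle
      _ = p ^ r * (p * (QuotientAddGroup.mk' H '' A).ncard) := by ring
      _ ≤ p ^ r * ((m + 1) * p ^ (n - r)) := Nat.mul_le_mul_left _ hih
      _ = (m + 1) * p ^ n := by
          rw [← hquot, hcq]; ring

/-- Every `(k,ℓ)`-sum-free subset `A ⊆ F_p^n` satisfies
`|A| ≤ (m+1)·p^(n-1)`. -/
theorem stmt0 (k l n m lam p : ℕ) (hlk : l < k) (hl : 1 ≤ l) (hn : 1 ≤ n) (hm : 1 ≤ m)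
    (hlam : lam ≤ k + l - 3) (hp : p = (k + l) * m + 2 + lam) (hpp : p.Prime)
    (A : Set (Fin n → ZMod p)) (hA : A.Nonempty) (hfree : KLFree k l A) :
    A.ncard ≤ (m + 1) * p ^ (n - 1) := by
  have := Fact.mk hpp
  have hcard : Nat.card (Fin n → ZMod p) = p ^ n := by simp
  have hlt : p < (k + l) * (m + 1) := by
    rw [mul_add, mul_one]
    omega
  have h := mul_ncard_le_of_klFree (hl.trans hlk.le) hpp hlt n hcard A hfree
  obtain ⟨n, rfl⟩ := Nat.exists_eq_add_of_le' hn
  refine Nat.le_of_mul_le_mul_left ?_ hpp.pos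
  rw [Nat.add_sub_cancel]
  calc p * A.ncard ≤ (m + 1) * p ^ (n + 1) := h
    _ = p * ((m + 1) * p ^ n) := by ring
end

section
/- Let k > ℓ ≥ 1 and n ≥ 1 be integers, let m ≥ 1 and λ be integers with 0 ≤ λ ≤ k+ℓ−3, and let p = (k+ℓ)m+2+λ be a prime. If A ⊆ F_p^n is (k,ℓ)-sum-free with |A| = (m+1)·p^{n−1}, then there exist an automorphism f of the additive group (F_p^n,+) and an integer j ∈ {0, ..., ⌈(λ+1)/2⌉−1} such that f(A) = A_{k,ℓ,p,j}. Moreover, for distinct j, j' ∈ {0, ..., ⌈(λ+1)/2⌉−1}, the cuboids A_{k,ℓ,p,j} and A_{k,ℓ,p,j'} are not isomorphic. -/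
open Pointwise

/-- Submodularity of `X ↦ |X + S|`. -/
lemma card_inter_add_add_card_union_add_le {G : Type*} [AddCommGroup G] [DecidableEq G]
    (X Y S : Finset G) :
    ((X ∩ Y) + S).card + ((X ∪ Y) + S).card ≤ (X + S).card + (Y + S).card := by
  rw [Finset.union_add, ← Finset.card_union_add_card_inter (X + S) (Y + S), add_comm]
  gcongr
  exact Finset.inter_add_subset

/-- The negated complement of `X + S` is dual to `X`. -/
lemma card_neg_compl_add_le {G : Type*} [AddCommGroup G] [Fintype G] [DecidableEq G]
    (X S : Finset G) : (-(X + S)ᶜ + S).card + X.card ≤ Fintype.card G := by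
  have h : -(X + S)ᶜ + S ⊆ (-X)ᶜ := by
    intro z hz
    obtain ⟨u, hu, s, hs, rfl⟩ := Finset.mem_add.1 hz
    rw [Finset.mem_neg'] at hu
    rw [Finset.mem_compl, Finset.mem_neg']
    intro hx
    refine Finset.mem_compl.1 hu ?_
    have := Finset.add_mem_add hx hs
    simpa using this
  have h1 := Finset.card_le_card h
  have h2 := Finset.card_compl_add_card (-X)
  rw [Finset.card_neg] at h2
  omega

/-- Intersection property of `i`-atoms: two distinct translates of an `i`-atom `M` of `S`
meet in fewer than `i` points. -/
lemma card_inter_vadd_lt_of_atom {G : Type*} [AddCommGroup G] [Fintype G] [DecidableEq G]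
    {i c : ℕ} {M S : Finset G}
    (hmin : ∀ X : Finset G, i ≤ X.card → (X + S).card + i ≤ Fintype.card G →
      X.card + c ≤ (X + S).card)
    (hMi : i ≤ M.card) (hMS : (M + S).card + i ≤ Fintype.card G)
    (hMc : (M + S).card = M.card + c)
    (hatom : ∀ X : Finset G, i ≤ X.card → (X + S).card + i ≤ Fintype.card G →
      (X + S).card = X.card + c → M.card ≤ X.card) (x : G) (hx : x +ᵥ M ≠ M) :
    (M ∩ (x +ᵥ M)).card < i := by
  by_contra! hlt
  have hYS : ((x +ᵥ M) + S).card = M.card + c := by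
    rw [vadd_add_assoc, Finset.card_vadd_finset, hMc]
  have hYc : (x +ᵥ M).card = M.card := Finset.card_vadd_finset _ _
  have hcompl := Finset.card_compl_add_card (M + S)
  have hdual := card_neg_compl_add_le M S
  have hneg : (-(M + S)ᶜ).card = (M + S)ᶜ.card := Finset.card_neg _
  have hD1 := hmin (-(M + S)ᶜ) (by omega) (by omega)
  have hD2 := hatom (-(M + S)ᶜ) (by omega) (by omega) (by omega)
  have hsub := card_inter_add_add_card_union_add_le M (x +ᵥ M) S
  have hunion := Finset.card_union_add_card_inter M (x +ᵥ M)
  have hle : ((M ∩ (x +ᵥ M)) + S).card ≤ (M + S).card :=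
    Finset.card_le_card (Finset.add_subset_add_right Finset.inter_subset_left)
  have hI := hmin _ hlt (by omega)
  have hUi : i ≤ (M ∪ (x +ᵥ M)).card := hMi.trans (Finset.card_le_card Finset.subset_union_left)
  have hU := hmin _ hUi (by omega)
  have hfin := hatom _ hlt (by omega) (by omega)
  have heq : M ∩ (x +ᵥ M) = M := Finset.eq_of_subset_of_card_le Finset.inter_subset_left hfin
  have hss : M ⊆ x +ᵥ M := Finset.inter_eq_left.1 heq
  exact hx (Finset.eq_of_subset_of_card_le hss hYc.le).symm

/-- If the `i`-isoperimetric inequality for `S` with constant `c` fails, there is an atom. -/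
lemma exists_atom {G : Type*} [AddCommGroup G] [Fintype G] [DecidableEq G]
    {i : ℕ} {S X : Finset G} (hS : S.Nonempty) (hX : i ≤ X.card)
    (hXS : (X + S).card + i ≤ Fintype.card G) :
    ∃ (c : ℕ) (M : Finset G), X.card + c ≤ (X + S).card ∧
      (∀ X : Finset G, i ≤ X.card → (X + S).card + i ≤ Fintype.card G →
        X.card + c ≤ (X + S).card) ∧
      i ≤ M.card ∧ (M + S).card + i ≤ Fintype.card G ∧ (M + S).card = M.card + c ∧
      ∀ X : Finset G, i ≤ X.card → (X + S).card + i ≤ Fintype.card G →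
        (X + S).card = X.card + c → M.card ≤ X.card := by
  have hle (Y : Finset G) : Y.card ≤ (Y + S).card := Finset.card_le_card_add_right hS
  obtain ⟨N, ⟨hN1, hN2⟩, hNmin⟩ := exists_minimalFor_of_wellFoundedLT
    (fun Y : Finset G => i ≤ Y.card ∧ (Y + S).card + i ≤ Fintype.card G)
    (fun Y => (Y + S).card - Y.card) ⟨X, hX, hXS⟩
  have hmin (Y : Finset G) (h1 : i ≤ Y.card) (h2 : (Y + S).card + i ≤ Fintype.card G) :
      Y.card + ((N + S).card - N.card) ≤ (Y + S).card := by
    have h3 := hNmin ⟨h1, h2⟩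
    have h4 := hle Y
    simp only at h3
    omega
  obtain ⟨M, ⟨hM1, hM2, hM3⟩, hMmin⟩ := exists_minimalFor_of_wellFoundedLT
    (fun Y : Finset G => i ≤ Y.card ∧ (Y + S).card + i ≤ Fintype.card G ∧
      (Y + S).card = Y.card + ((N + S).card - N.card))
    (fun Y => Y.card) ⟨N, hN1, hN2, by have := hle N; omega⟩
  refine ⟨_, M, hmin X hX hXS, hmin, hM1, hM2, hM3, fun Y h1 h2 h3 => ?_⟩
  have h4 := @hMmin Y ⟨h1, h2, h3⟩
  simp only at h4
  omega

/-- Mann's theorem. -/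
theorem exists_addSubgroup_card_add_lt {G : Type*} [AddCommGroup G] [Fintype G] [DecidableEq G]
    {S X : Finset G} (hS : S.Nonempty) (hX : X.Nonempty)
    (hXS : (X + S).card + 1 ≤ Fintype.card G) (hlt : (X + S).card + 1 < X.card + S.card) :
    ∃ (H : AddSubgroup G) (M : Finset G), (M : Set G) = H ∧
      (M + S).card + 1 ≤ Fintype.card G ∧ (M + S).card + 1 < M.card + S.card := by
  obtain ⟨c, M, hXc, hmin, hM1, hM2, hM3, hatom⟩ := exists_atom hS hX.card_pos hXS
  obtain ⟨a, ha⟩ := Finset.card_pos.1 hM1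
  have hper : ∀ x ∈ M, ∀ y ∈ M, (x - y) +ᵥ M = M := by
    intro x hx y hy
    by_contra hne
    have h1 := card_inter_vadd_lt_of_atom hmin hM1 hM2 hM3 hatom (x - y) hne
    have h2 : x ∈ M ∩ ((x - y) +ᵥ M) := by
      rw [Finset.mem_inter, Finset.mem_vadd_finset]
      exact ⟨hx, y, hy, by simp⟩
    have := Finset.card_pos.2 ⟨x, h2⟩
    omega
  have hmem (x y : G) : x ∈ (-y) +ᵥ M ↔ x + y ∈ M := by
    rw [Finset.mem_vadd_finset]
    constructor
    · rintro ⟨z, hz, rfl⟩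
      simpa using hz
    · intro h
      exact ⟨_, h, by simp⟩
  let H : AddSubgroup G := AddSubgroup.ofSub ((-a +ᵥ M : Finset G) : Set G)
    ⟨0, by rw [Finset.mem_coe, hmem]; simpa using ha⟩ (by
      intro x hx y hy
      simp only [Finset.mem_coe, hmem] at hx hy ⊢
      have := hper _ hx _ hy
      rw [← this, Finset.mem_vadd_finset]
      exact ⟨a, ha, by simp; abel⟩)
  refine ⟨H, -a +ᵥ M, rfl, ?_, ?_⟩
  · rwa [vadd_add_assoc, Finset.card_vadd_finset]
  · rw [vadd_add_assoc, Finset.card_vadd_finset, Finset.card_vadd_finset]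
    omega

/-- A proper subset of `ZMod p` that gains at most one point when a translate is added is an
arithmetic progression. -/
lemma exists_eq_image_of_card_add_pair_le {p : ℕ} [Fact p.Prime] {S : Finset (ZMod p)}
    (hS : S.Nonempty) {d : ZMod p} (hd : d ≠ 0)
    (hlt : S.card < p) (hcard : (S \ (S.image (· - d))).card ≤ 1) :
    ∃ a : ZMod p, S = (Finset.range S.card).image fun j : ℕ => a + j * d := by
  have hclosed (T : Finset (ZMod p)) (hT : T.Nonempty) (hTd : ∀ x ∈ T, x + d ∈ T) :
      ∀ y, y ∈ T := by
    obtain ⟨x, hx⟩ := hT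
    have hn (j : ℕ) : x + j * d ∈ T := by
      induction j with
      | zero => simpa using hx
      | succ j ih =>
        have := hTd _ ih
        rwa [show x + (j : ZMod p) * d + d = x + ((j + 1 : ℕ) : ZMod p) * d by push_cast; ring]
          at this
    intro y
    have := hn ((y - x) * d⁻¹).val
    rw [ZMod.natCast_zmod_val] at this
    rwa [mul_assoc, inv_mul_cancel₀ hd, mul_one, add_sub_cancel] at this
  have hne (T : Finset (ZMod p)) (hTS : T ⊆ S) (hT : ∀ y, y ∈ T) : False := by
    have h1 := Finset.card_le_card hTS
    rw [Finset.eq_univ_iff_forall.2 hT, Finset.card_univ, ZMod.card] at h1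
    omega
  have huniq (x y : ZMod p) (hx : x ∈ S) (hxd : x + d ∉ S) (hy : y ∈ S) (hyd : y + d ∉ S) :
      x = y := by
    refine Finset.card_le_one.1 hcard x ?_ y ?_
    · simp only [Finset.mem_sdiff, Finset.mem_image, hx, true_and, not_exists, not_and]
      rintro z hz rfl
      simp [hz] at hxd
    · simp only [Finset.mem_sdiff, Finset.mem_image, hy, true_and, not_exists, not_and]
      rintro z hz rfl
      simp [hz] at hyd
  obtain ⟨a, ha, had⟩ : ∃ a ∈ S, a - d ∉ S := by
    by_contra! h
    refine hne S subset_rfl fun y => ?_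
    obtain ⟨x, hx⟩ := hS
    have hn (j : ℕ) : x - j * d ∈ S := by
      induction j with
      | zero => simpa using hx
      | succ j ih =>
        have := h _ ih
        rwa [show x - (j : ZMod p) * d - d = x - ((j + 1 : ℕ) : ZMod p) * d by push_cast; ring]
          at this
    have := hn ((x - y) * d⁻¹).val
    rw [ZMod.natCast_zmod_val] at this
    rwa [mul_assoc, inv_mul_cancel₀ hd, mul_one, sub_sub_cancel] at this
  have hex : ∃ j : ℕ, a + j * d ∉ S := by
    refine ⟨p - 1, ?_⟩
    have hp : 1 ≤ p := (Fact.out : p.Prime).one_le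
    rw [Nat.cast_sub hp]
    simpa [← sub_eq_add_neg] using had
  classical
  obtain ⟨r, hr, hmin⟩ : ∃ r : ℕ, a + r * d ∉ S ∧ ∀ j < r, a + j * d ∈ S :=
    ⟨Nat.find hex, Nat.find_spec hex, fun j hj => not_not.1 (Nat.find_min hex hj)⟩
  have hr0 : r ≠ 0 := by
    rintro rfl
    simp [ha] at hr
  have hrp : r ≤ p := by
    by_contra! h
    have h0 := hmin (p - 1) (by omega)
    have hp : 1 ≤ p := (Fact.out : p.Prime).one_le
    rw [Nat.cast_sub hp] at h0
    simp [← sub_eq_add_neg, had] at h0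
  set I : Finset (ZMod p) := (Finset.range r).image fun j : ℕ => a + j * d with hI
  have hIS : I ⊆ S := by
    intro x hx
    obtain ⟨j, hj, rfl⟩ := Finset.mem_image.1 hx
    exact hmin j (Finset.mem_range.1 hj)
  have hend : a + ((r - 1 : ℕ) : ZMod p) * d + d ∉ S := by
    rwa [show a + ((r - 1 : ℕ) : ZMod p) * d + d = a + ((r - 1 + 1 : ℕ) : ZMod p) * d by
      push_cast; ring, Nat.sub_add_cancel (by omega)]
  have hSI : S \ I = ∅ := by
    by_contra hnon
    refine hne (S \ I) Finset.sdiff_subset (hclosed _ (Finset.nonempty_iff_ne_empty.2 hnon) ?_)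
    intro x hx
    obtain ⟨hxS, hxI⟩ := Finset.mem_sdiff.1 hx
    refine Finset.mem_sdiff.2 ⟨?_, fun hxd => ?_⟩
    · by_contra hxd
      have := huniq x _ hxS hxd (hmin (r - 1) (by omega)) hend
      exact hxI (Finset.mem_image.2 ⟨r - 1, Finset.mem_range.2 (by omega), this.symm⟩)
    · obtain ⟨j, hj, hjx⟩ := Finset.mem_image.1 hxd
      rcases j with _ | j
      · simp only [Nat.cast_zero, zero_mul, add_zero] at hjx
        rw [hjx, add_sub_cancel_right] at had
        exact had hxS
      · refine hxI (Finset.mem_image.2 ⟨j, Finset.mem_range.2 ?_, ?_⟩)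
        · have := Finset.mem_range.1 hj
          omega
        · push_cast at hjx
          linear_combination hjx
  have hSeq : S = I := Finset.Subset.antisymm (Finset.sdiff_eq_empty_iff_subset.1 hSI) hIS
  have hIcard : I.card = r := by
    rw [hI, Finset.card_image_of_injOn, Finset.card_range]
    intro x hx y hy hxy
    have hx' : x < r := by simpa using hx
    have hy' : y < r := by simpa using hy
    have h1 : (x : ZMod p) = y := mul_right_cancel₀ hd (add_left_cancel hxy)
    rw [ZMod.natCast_eq_natCast_iff'] at h1
    rwa [Nat.mod_eq_of_lt (by omega), Nat.mod_eq_of_lt (by omega)] at h1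
  refine ⟨a, ?_⟩
  rw [hSeq, hIcard]

/-- A set `S` whose sum with some two-element set has at most `|S| + 1` elements is an
arithmetic progression. -/
lemma exists_eq_image_of_card_two {p : ℕ} [Fact p.Prime] {S M : Finset (ZMod p)}
    (hS : S.Nonempty) (hM : M.card = 2) (hlt : S.card < p)
    (hcard : (M + S).card ≤ S.card + 1) :
    ∃ a d : ZMod p, d ≠ 0 ∧ S = (Finset.range S.card).image fun j : ℕ => a + j * d := by
  obtain ⟨x, y, hxy, rfl⟩ := Finset.card_eq_two.1 hM
  have hd : y - x ≠ 0 := sub_ne_zero.2 hxy.symm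
  obtain ⟨a, ha⟩ := exists_eq_image_of_card_add_pair_le hS hd hlt (by
    have hsub : (S \ (S.image (· - (y - x)))).image (y + ·) ∪ S.image (x + ·) ⊆ {x, y} + S := by
      intro z hz
      rcases Finset.mem_union.1 hz with hz | hz
      · obtain ⟨s, hs, rfl⟩ := Finset.mem_image.1 hz
        exact Finset.add_mem_add (by simp) (Finset.mem_sdiff.1 hs).1
      · obtain ⟨s, hs, rfl⟩ := Finset.mem_image.1 hz
        exact Finset.add_mem_add (by simp) hs
    have hdisj : Disjoint ((S \ (S.image (· - (y - x)))).image (y + ·)) (S.image (x + ·)) := by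
      rw [Finset.disjoint_left]
      intro z hz hz'
      obtain ⟨s, hs, rfl⟩ := Finset.mem_image.1 hz
      obtain ⟨t, ht, hts⟩ := Finset.mem_image.1 hz'
      refine (Finset.mem_sdiff.1 hs).2 (Finset.mem_image.2 ⟨t, ht, ?_⟩)
      linear_combination hts
    have h1 := Finset.card_le_card hsub
    rw [Finset.card_union_of_disjoint hdisj,
      Finset.card_image_of_injective _ (add_right_injective y),
      Finset.card_image_of_injective _ (add_right_injective x)] at h1
    omega)
  exact ⟨a, y - x, hd, ha⟩

/-- If nontrivial translates of `M` meet `M` in at most one point, then `M + S` is large for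
every `S` with `3 ≤ |S| ≤ |M|`. -/
lemma card_add_card_le_of_card_inter_vadd_le_one {G : Type*} [AddCommGroup G] [DecidableEq G]
    {M S : Finset G} (hM : ∀ x : G, x ≠ 0 → (M ∩ (x +ᵥ M)).card ≤ 1)
    (h3 : 3 ≤ S.card) (hle : S.card ≤ M.card) : M.card + S.card ≤ (M + S).card := by
  obtain ⟨T, hTS, hT⟩ := Finset.exists_subset_card_eq h3
  obtain ⟨x, y, z, hxy, hxz, hyz, rfl⟩ := Finset.card_eq_three.1 hT
  have hinter (u v : G) (huv : u ≠ v) : ((u +ᵥ M) ∩ (v +ᵥ M)).card ≤ 1 := by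
    have := hM (v - u) (sub_ne_zero.2 huv.symm)
    rw [← Finset.card_vadd_finset u, Finset.vadd_finset_inter, vadd_vadd, add_sub_cancel] at this
    exact this
  have hsub : (x +ᵥ M) ∪ (y +ᵥ M) ∪ (z +ᵥ M) ⊆ M + S := by
    have h (u : G) (hu : u ∈ ({x, y, z} : Finset G)) : u +ᵥ M ⊆ M + S := by
      intro w hw
      obtain ⟨v, hv, rfl⟩ := Finset.mem_vadd_finset.1 hw
      rw [vadd_eq_add, add_comm u v]
      exact Finset.add_mem_add hv (hTS hu)
    exact Finset.union_subset (Finset.union_subset (h x (by simp)) (h y (by simp))) (h z (by simp))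
  have h1 := Finset.card_le_card hsub
  have h2 := Finset.card_union_add_card_inter (x +ᵥ M) (y +ᵥ M)
  have h4 := Finset.card_union_add_card_inter ((x +ᵥ M) ∪ (y +ᵥ M)) (z +ᵥ M)
  rw [Finset.union_inter_distrib_right] at h4
  have h5 := Finset.card_union_le ((x +ᵥ M) ∩ (z +ᵥ M)) ((y +ᵥ M) ∩ (z +ᵥ M))
  have h6 := hinter x y hxy
  have h7 := hinter x z hxz
  have h8 := hinter y z hyz
  simp only [Finset.card_vadd_finset] at h2 h4
  omega

/-- In `ZMod p`, a proper nonempty subset has no nontrivial period. -/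
lemma vadd_finset_ne_self {p : ℕ} [Fact p.Prime] {M : Finset (ZMod p)} (hM : M.Nonempty)
    (hlt : M.card < p) {x : ZMod p} (hx : x ≠ 0) : x +ᵥ M ≠ M := by
  intro h
  obtain ⟨a, ha⟩ := hM
  have hn (j : ℕ) : a + j * x ∈ M := by
    induction j with
    | zero => simpa using ha
    | succ j ih =>
      have : x +ᵥ (a + j * x) ∈ x +ᵥ M := Finset.vadd_mem_vadd_finset ih
      rw [h, vadd_eq_add] at this
      rwa [show a + ((j + 1 : ℕ) : ZMod p) * x = x + (a + j * x) by push_cast; ring]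
  have huniv : M = Finset.univ := by
    rw [Finset.eq_univ_iff_forall]
    intro y
    have := hn ((y - a) * x⁻¹).val
    rw [ZMod.natCast_zmod_val] at this
    rwa [mul_assoc, inv_mul_cancel₀ hx, mul_one, add_sub_cancel] at this
  rw [huniv, Finset.card_univ, ZMod.card] at hlt
  exact lt_irrefl _ hlt

/-- A critical pair `(X, S)` in `ZMod p` yields a two-element set or a set with the Sidon
property forming a critical pair with `S`. -/
lemma exists_critical_atom {p : ℕ} [Fact p.Prime] {S X : Finset (ZMod p)} (hS : 2 ≤ S.card)
    (hX : 2 ≤ X.card) (hXS : (X + S).card + 2 ≤ p) (hlt : (X + S).card < X.card + S.card) :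
    ∃ M : Finset (ZMod p), 2 ≤ M.card ∧ (M + S).card + 2 ≤ p ∧
      (M + S).card < M.card + S.card ∧ ∀ x : ZMod p, x ≠ 0 → (M ∩ (x +ᵥ M)).card ≤ 1 := by
  have hS0 : S.Nonempty := Finset.card_pos.1 (by omega)
  obtain ⟨c, M, hXc, hmin, hM1, hM2, hM3, hatom⟩ := exists_atom (i := 2) hS0 hX
    (by rwa [ZMod.card])
  refine ⟨M, hM1, by rwa [ZMod.card] at hM2, by omega, fun x hx => ?_⟩
  rw [ZMod.card] at hM2
  have hne := vadd_finset_ne_self (M := M) (Finset.card_pos.1 (by omega)) (by omega) hx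
  exact Nat.lt_succ_iff.1 (card_inter_vadd_lt_of_atom hmin hM1 (by rwa [ZMod.card]) hM3 hatom x hne)

/-- Vosper's theorem. -/
theorem exists_eq_image_of_card_add_lt {p : ℕ} [Fact p.Prime] {S X : Finset (ZMod p)}
    (hS : 2 ≤ S.card) (hX : 2 ≤ X.card) (hXS : (X + S).card + 2 ≤ p)
    (hlt : (X + S).card < X.card + S.card) :
    ∃ a d : ZMod p, d ≠ 0 ∧ S = (Finset.range S.card).image fun j : ℕ => a + j * d := by
  have hsmall {Y T : Finset (ZMod p)} (hY : 2 ≤ Y.card) (h : (Y + T).card + 2 ≤ p) :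
      T.card < p := by
    have := Finset.card_le_card_add_left (s := Y) (t := T) (Finset.card_pos.1 (by omega))
    omega
  have hS0 : S.Nonempty := Finset.card_pos.1 (by omega)
  obtain ⟨M, hM2, hMS, hMlt, hM⟩ := exists_critical_atom hS hX hXS hlt
  rcases hM2.eq_or_lt with hM2 | hM3
  · exact exists_eq_image_of_card_two hS0 hM2.symm (hsmall hM2.le hMS) (by omega)
  exfalso
  obtain ⟨N, hN2, hNM, hNlt, hN⟩ := exists_critical_atom hM2 hS (by rwa [add_comm S M])
    (by rw [add_comm S M]; omega)
  rcases hN2.eq_or_lt with hN2 | hN3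
  · obtain ⟨a, d, hd, had⟩ := exists_eq_image_of_card_two (Finset.card_pos.1 (by omega))
      hN2.symm (hsmall hN2.le hNM) (by omega)
    have hmem (j : ℕ) (hj : j < M.card) : a + j * d ∈ M := by
      rw [had]
      exact Finset.mem_image.2 ⟨j, by simpa using hj, rfl⟩
    have h0 := hmem 0 (by omega)
    have h1 := hmem 1 (by omega)
    have h2 := hmem 2 (by omega)
    have heq := Finset.card_le_one.1 (hM d hd) (a + (1 : ℕ) * d)
      (Finset.mem_inter.2 ⟨h1, Finset.mem_vadd_finset.2 ⟨_, h0, by simp; ring⟩⟩)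
      (a + (2 : ℕ) * d)
      (Finset.mem_inter.2 ⟨h2, Finset.mem_vadd_finset.2 ⟨_, h1, by simp; ring⟩⟩)
    apply hd
    push_cast at heq
    linear_combination -heq
  · rcases le_total N.card M.card with h | h
    · have := card_add_card_le_of_card_inter_vadd_le_one hM hN3 h
      rw [add_comm M N] at this
      omega
    · have := card_add_card_le_of_card_inter_vadd_le_one hN hM3 h
      omega

lemma itSum_coe {G : Type*} [AddCommGroup G] [DecidableEq G] (h : ℕ) (A : Finset G) :
    itSum h (A : Set G) = ((h • A : Finset G) : Set G) := by
  induction h with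
  | zero => rw [itSum, zero_nsmul, Finset.coe_zero, Set.singleton_zero]
  | succ h ih => rw [itSum, ih, succ_nsmul, Finset.coe_add]

lemma itSum_image {G G' : Type*} [AddCommGroup G] [AddCommGroup G'] (q : G →+ G') (h : ℕ)
    (A : Set G) : itSum h (q '' A) = q '' itSum h A := by
  induction h with
  | zero => simp [itSum]
  | succ h ih => rw [itSum, ih, itSum, Set.image_add]

/-- Sum-freeness passes to the image under a homomorphism for which the set is saturated. -/
lemma KLFree.image {G G' : Type*} [AddCommGroup G] [AddCommGroup G'] {k l : ℕ} (hl : 1 ≤ l)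
    {A : Set G} (hA : KLFree k l A) (q : G →+ G') (hq : q ⁻¹' (q '' A) ⊆ A) :
    KLFree k l (q '' A) := by
  rw [KLFree, Set.eq_empty_iff_forall_notMem]
  rintro z ⟨hz1, hz2⟩
  rw [itSum_image] at hz1 hz2
  obtain ⟨x, hx, rfl⟩ := hz1
  obtain ⟨y, hy, hyx⟩ := hz2
  obtain ⟨l, rfl⟩ := Nat.exists_eq_add_of_le' hl
  obtain ⟨s, hs, a, ha, rfl⟩ := hy
  refine Set.eq_empty_iff_forall_notMem.1 hA x ⟨hx, s, hs, x - s, hq ⟨a, ha, ?_⟩, by simp⟩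
  rw [map_sub, ← hyx]
  simp

/-- Lower bound for `|hA|` from an isoperimetric inequality. -/
lemma card_nsmul_ge {G : Type*} [AddCommGroup G] [Fintype G] [DecidableEq G] {i c : ℕ}
    {A : Finset G} (hA : A.Nonempty) (hi : i ≤ A.card)
    (hgrow : ∀ X : Finset G, i ≤ X.card → (X + A).card + i ≤ Fintype.card G →
      X.card + c ≤ (X + A).card) (h : ℕ)
    (hlt : ((h + 1) • A).card + i ≤ Fintype.card G) :
    A.card + h * c ≤ ((h + 1) • A).card := by
  induction h with
  | zero => simp
  | succ h ih =>
    rw [succ_nsmul _ (h + 1)] at hlt ⊢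
    have hle := Finset.card_le_card_add_right (s := (h + 1) • A) hA
    have h1 := ih (by omega)
    have h2 := hgrow _ (by omega) hlt
    rw [add_mul]
    omega

/-- Size bound for sum-free sets satisfying an isoperimetric inequality. -/
lemma KLFree.card_le {G : Type*} [AddCommGroup G] [Fintype G] [DecidableEq G] {i c k l : ℕ}
    {A : Finset G} (hk : 1 ≤ k) (hl : 1 ≤ l) (hfree : KLFree k l (A : Set G))
    (hA : A.Nonempty) (hi : i ≤ A.card)
    (hgrow : ∀ X : Finset G, i ≤ X.card → (X + A).card + i ≤ Fintype.card G →
      X.card + c ≤ (X + A).card) :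
    2 * A.card + (k + l - 2) * c ≤ Fintype.card G := by
  obtain ⟨k, rfl⟩ := Nat.exists_eq_add_of_le' hk
  obtain ⟨l, rfl⟩ := Nat.exists_eq_add_of_le' hl
  have hdisj : Disjoint ((k + 1) • A) ((l + 1) • A) := by
    rw [← Finset.disjoint_coe, Set.disjoint_iff_inter_eq_empty, ← itSum_coe, ← itSum_coe]
    exact hfree
  have hle := Finset.card_le_univ (((k + 1) • A) ∪ ((l + 1) • A))
  rw [Finset.card_union_of_disjoint hdisj] at hle
  have hA' (h : ℕ) : A.card ≤ ((h + 1) • A).card := by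
    induction h with
    | zero => simp
    | succ h ih =>
      rw [succ_nsmul _ (h + 1)]
      exact ih.trans (Finset.card_le_card_add_right hA)
  have hk' := hA' k
  have hl' := hA' l
  have h1 := card_nsmul_ge hA hi hgrow k (by omega)
  have h2 := card_nsmul_ge hA hi hgrow l (by omega)
  rw [show k + 1 + (l + 1) - 2 = k + l by omega, add_mul]
  omega

lemma card_preimage_mkQ {R V : Type*} [Ring R] [AddCommGroup V] [Module R V] [Finite V]
    (W : Submodule R V) (T : Set (V ⧸ W)) :
    (W.mkQ ⁻¹' T).ncard = Nat.card W * T.ncard := by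
  have := Nat.card_congr (QuotientAddGroup.preimageMkEquivAddSubgroupProdSet W.toAddSubgroup T)
  rw [Nat.card_prod] at this
  exact this

/-- A sum-free set of maximum size in a vector space over `ZMod p` is the preimage of a set
under a nonzero linear functional. -/
theorem exists_functional_eq_preimage {k l m lam p : ℕ} [Fact p.Prime] (hlk : l < k) (hl : 1 ≤ l)
    (hlam : lam ≤ k + l - 3) (hp : p = (k + l) * m + 2 + lam) (hm : 1 ≤ m) (n : ℕ)
    {V : Type*} [AddCommGroup V] [Module (ZMod p) V] [Finite V]
    (hV : Module.finrank (ZMod p) V = n + 1) {A : Set V} (hfree : KLFree k l A)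
    (hcard : A.ncard = (m + 1) * p ^ n) :
    ∃ (f : V →ₗ[ZMod p] ZMod p) (B : Set (ZMod p)), Function.Surjective f ∧ A = f ⁻¹' B := by
  induction n using Nat.strong_induction_on generalizing V with
  | _ n ih =>
  have : Fintype V := Fintype.ofFinite V
  classical
  have hpp : p.Prime := Fact.out
  rcases n with _ | n
  · have e : V ≃ₗ[ZMod p] ZMod p := LinearEquiv.ofFinrankEq _ _ (by rw [hV]; simp)
    refine ⟨e, e '' A, e.surjective, ?_⟩
    exact (Set.preimage_image_eq _ e.injective).symm
  lift A to Finset V using A.toFinite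
  rw [Set.ncard_coe_finset] at hcard
  have hVcard : Fintype.card V = p ^ (n + 2) := by
    rw [Module.card_eq_pow_finrank (K := ZMod p), hV, ZMod.card]
  have hApos : 0 < A.card := by
    rw [hcard]
    have := pow_pos hpp.pos (n + 1)
    positivity
  have hA0 : A.Nonempty := Finset.card_pos.1 hApos
  have hbad : ∃ X : Finset V, 1 ≤ X.card ∧ (X + A).card + 1 ≤ Fintype.card V ∧
      (X + A).card < X.card + (A.card - 1) := by
    by_contra! hgrow
    have h1 := KLFree.card_le (by omega) hl hfree hA0 hApos hgrow
    obtain ⟨s, hs⟩ : ∃ s, k + l = s + 2 := ⟨k + l - 2, by omega⟩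
    obtain ⟨b, hb⟩ : ∃ b, A.card = b + 1 := ⟨A.card - 1, by omega⟩
    have hP : p ≤ p ^ (n + 1) := Nat.le_self_pow (by omega) p
    rw [hVcard, pow_succ, show k + l - 2 = s by omega, hb, Nat.add_sub_cancel] at h1
    rw [hs] at hp hlam
    have h2 : (s + 2) * (m + 1) ≥ p + 1 := by
      rw [mul_add]
      omega
    have h3 : s < p := by
      have : s + 2 ≤ (s + 2) * m := Nat.le_mul_of_pos_right _ hm
      omega
    rw [hb] at hcard
    nlinarith [Nat.mul_le_mul_right (p ^ (n + 1)) h2]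
  obtain ⟨X, hX1, hX2, hX3⟩ := hbad
  obtain ⟨H, M, hMH, hM1, hM2⟩ := exists_addSubgroup_card_add_lt hA0 (Finset.card_pos.1 hX1) hX2
    (by omega)
  let W : Submodule (ZMod p) V := AddSubgroup.toZModSubmodule p H
  have hWM (x : V) : x ∈ W ↔ x ∈ M := by
    rw [← Finset.mem_coe, hMH]
    rfl
  have hWcard : Nat.card W = M.card := by
    rw [← Set.ncard_coe_finset, ← Nat.card_coe_set_eq]
    exact Nat.card_congr (Equiv.subtypeEquivRight hWM)
  have hWpow : Nat.card W = p ^ Module.finrank (ZMod p) W := by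
    rw [Module.natCard_eq_pow_finrank (K := ZMod p), Nat.card_zmod]
  have hfr := W.finrank_quotient_add_finrank
  rw [hV] at hfr
  have hpre : W.mkQ ⁻¹' (W.mkQ '' (A : Set V)) = ((M + A : Finset V) : Set V) := by
    ext x
    simp only [Set.mem_preimage, Set.mem_image, Finset.mem_coe, Finset.mem_add]
    constructor
    · rintro ⟨a, ha, hax⟩
      refine ⟨x - a, ?_, a, ha, by simp⟩
      rw [← hWM, ← Submodule.ker_mkQ W, LinearMap.mem_ker, map_sub, hax, sub_self]
    · rintro ⟨w, hw, a, ha, rfl⟩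
      refine ⟨a, ha, ?_⟩
      rw [← hWM, ← Submodule.ker_mkQ W, LinearMap.mem_ker] at hw
      rw [map_add, hw, zero_add]
  have hcount := card_preimage_mkQ W (W.mkQ '' (A : Set V))
  rw [hpre, Set.ncard_coe_finset] at hcount
  set d := Module.finrank (ZMod p) W with hd
  have h0M : (0 : V) ∈ M := (hWM 0).1 W.zero_mem
  have hAle : A.card ≤ (M + A).card := Finset.card_le_card_add_left ⟨0, h0M⟩
  have hd0 : d ≠ 0 := by
    intro h
    rw [h, pow_zero] at hWpow
    omega
  have hdn : d ≤ n + 1 := by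
    by_contra! h
    have hdeq : d = n + 2 := by omega
    have := Finset.card_le_card_add_right (s := M) hA0
    rw [hdeq] at hWpow
    omega
  obtain ⟨r, hr⟩ := Nat.exists_eq_add_of_le' hdn
  have hPpos : 0 < p ^ d := pow_pos hpp.pos d
  have hA' : A.card = p ^ d * ((m + 1) * p ^ r) := by
    rw [hcard, hr, pow_add]
    ring
  rw [hWpow] at hcount hWcard
  have hquot : (W.mkQ '' (A : Set V)).ncard = (m + 1) * p ^ r := by
    have h1 : (m + 1) * p ^ r ≤ (W.mkQ '' (A : Set V)).ncard := by
      refine Nat.le_of_mul_le_mul_left ?_ hPpos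
      rw [← hcount, ← hA']
      exact hAle
    have h2 : (W.mkQ '' (A : Set V)).ncard < (m + 1) * p ^ r + 1 := by
      refine Nat.lt_of_mul_lt_mul_left (a := p ^ d) ?_
      rw [← hcount, mul_add, ← hA', mul_one, hWcard]
      omega
    omega
  have hsat : W.mkQ ⁻¹' (W.mkQ '' (A : Set V)) = A := by
    rw [hpre, Finset.coe_inj]
    refine (Finset.eq_of_subset_of_card_le ?_ ?_).symm
    · intro a ha
      exact Finset.mem_add.2 ⟨0, h0M, a, ha, zero_add a⟩
    · rw [hcount, hA', hquot]
  obtain ⟨f, B, hf, hB⟩ := ih r (by omega) (V := V ⧸ W) (A := W.mkQ '' (A : Set V)) (by omega)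
    (hfree.image hl W.mkQ.toAddMonoidHom hsat.le) hquot
  refine ⟨f ∘ₗ W.mkQ, B, hf.comp W.mkQ_surjective, ?_⟩
  rw [← hsat, hB]
  rfl

/-- A surjective linear functional is the first coordinate in a suitable coordinate system. -/
lemma exists_linearEquiv_fst_eq {p n : ℕ} [Fact p.Prime] (hn : 1 ≤ n)
    (f : (Fin n → ZMod p) →ₗ[ZMod p] ZMod p) (hf : Function.Surjective f) :
    ∃ e : (Fin n → ZMod p) ≃ₗ[ZMod p] (ZMod p × (Fin (n - 1) → ZMod p)), ∀ v, (e v).1 = f v := by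
  have hker := f.finrank_range_add_finrank_ker
  rw [LinearMap.range_eq_top.2 hf, finrank_top] at hker
  simp only [Module.finrank_self, Module.finrank_fin_fun] at hker
  let g₀ : LinearMap.ker f ≃ₗ[ZMod p] (Fin (n - 1) → ZMod p) :=
    LinearEquiv.ofFinrankEq _ _ (by rw [Module.finrank_fin_fun]; omega)
  obtain ⟨g, hg⟩ := g₀.toLinearMap.exists_extend
  have hinj : Function.Injective (f.prod g) := by
    rw [← LinearMap.ker_eq_bot, LinearMap.ker_eq_bot']
    intro v hv
    obtain ⟨h1, h2⟩ := Prod.mk.inj hv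
    have h3 : g₀ ⟨v, h1⟩ = g v := by
      rw [← LinearEquiv.coe_coe, ← hg]
      rfl
    have h4 : (⟨v, h1⟩ : LinearMap.ker f) = 0 := by
      rw [← g₀.map_eq_zero_iff, h3]
      exact h2
    exact congrArg Subtype.val h4
  refine ⟨LinearEquiv.ofInjectiveOfFinrankEq (f.prod g) hinj ?_, fun v => rfl⟩
  rw [Module.finrank_prod, Module.finrank_fin_fun, Module.finrank_fin_fun, Module.finrank_self]
  omega

lemma ncard_cub (p n : ℕ) [NeZero p] (B : Set (ZMod p)) :
    {x : ZMod p × (Fin n → ZMod p) | x.1 ∈ B}.ncard = B.ncard * p ^ n := by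
  have h : {x : ZMod p × (Fin n → ZMod p) | x.1 ∈ B} = B ×ˢ Set.univ := by
    ext x
    simp
  rw [h, Set.ncard_prod, Set.ncard_univ, Nat.card_fun, Nat.card_zmod, Nat.card_fin]

/-- Elements of an iterated sumset of an interval. -/
lemma mul_add_mem_itSum_Ival {p : ℕ} (a : ZMod p) (t h i : ℕ) (hi : i ≤ h * t) :
    (h : ZMod p) * a + (i : ZMod p) ∈ itSum h (Ival a t) := by
  induction h generalizing i with
  | zero =>
    obtain rfl : i = 0 := by simpa using hi
    simp [itSum]
  | succ h ih =>
    rw [add_mul, one_mul] at hi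
    refine ⟨_, ih (i - min i t) (by omega), a + (min i t : ℕ), ⟨_, min_le_right _ _, rfl⟩, ?_⟩
    have h1 : (i : ZMod p) = ((i - min i t + min i t : ℕ) : ZMod p) := by
      rw [Nat.sub_add_cancel (min_le_left _ _)]
    rw [h1, Nat.cast_add]
    push_cast
    ring

lemma neg_Ival {p : ℕ} (a : ZMod p) (t : ℕ) :
    (fun x => -x) '' Ival a t = Ival (-a - (t : ZMod p)) t := by
  ext x
  constructor
  · rintro ⟨_, ⟨i, hi, rfl⟩, rfl⟩
    refine ⟨t - i, by omega, ?_⟩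
    rw [Nat.cast_sub hi]
    ring
  · rintro ⟨i, hi, rfl⟩
    refine ⟨a + (t - i : ℕ), ⟨t - i, by omega, rfl⟩, ?_⟩
    rw [Nat.cast_sub hi]
    ring

lemma cast_sub_ne_zero {k l p : ℕ} (hlk : l < k) (hkp : k < p) : ((k - l : ℕ) : ZMod p) ≠ 0 := by
  rw [Ne, ZMod.natCast_eq_zero_iff]
  exact fun h => absurd (Nat.le_of_dvd (by omega) h) (by omega)

/-- A sum-free interval is, up to sign, one of the extremal intervals. -/
lemma exists_eq_ajElt_of_KLFree_Ival {k l m lam p : ℕ} [Fact p.Prime] (hlk : l < k)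
    (hkp : k < p) (hp : p = (k + l) * m + 2 + lam) {a : ZMod p} (hfree : KLFree k l (Ival a m)) :
    ∃ j < (lam + 2) / 2, a = ajElt k l m p j ∨ -a - (m : ZMod p) = ajElt k l m p j := by
  have hkl0 := cast_sub_ne_zero hlk hkp
  have hkl : ((k - l : ℕ) : ZMod p) = k - l := Nat.cast_sub hlk.le
  have hpc : (((k + l) * m + 2 + lam : ℕ) : ZMod p) = 0 := by rw [← hp, ZMod.natCast_self]
  have hno (i i' : ℕ) (hi : i ≤ k * m) (hi' : i' ≤ l * m) : (k : ZMod p) * a + i ≠ l * a + i' :=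
    fun h => Set.eq_empty_iff_forall_notMem.1 hfree _
      ⟨mul_add_mem_itSum_Ival a m k i hi, h ▸ mul_add_mem_itSum_Ival a m l i' hi'⟩
  set r := (-((k - l : ℕ) : ZMod p) * a).val with hr
  have hrc : (r : ZMod p) = -((k : ZMod p) - l) * a := by rw [hr, ZMod.natCast_zmod_val, hkl]
  have hrp : r < p := ZMod.val_lt _
  rw [add_mul] at hp
  have h1 : k * m < r := by
    by_contra! h
    refine hno r 0 h (Nat.zero_le _) ?_
    rw [hrc]
    push_cast
    ring
  have h2 : r < p - l * m := by
    by_contra! h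
    refine hno 0 (p - r) (Nat.zero_le _) (by omega) ?_
    rw [Nat.cast_sub hrp.le, hrc, ZMod.natCast_self]
    push_cast
    ring
  obtain ⟨j, hj⟩ := Nat.exists_eq_add_of_le (show k * m + 1 ≤ r by omega)
  rw [hj] at hrc
  have hjl : j ≤ lam := by omega
  by_cases hjj : j < (lam + 2) / 2
  · refine ⟨j, hjj, Or.inl ?_⟩
    rw [ajElt, eq_mul_inv_iff_mul_eq₀ hkl0, hrc, hkl]
    ring
  · refine ⟨lam - j, by omega, Or.inr ?_⟩
    rw [ajElt, eq_mul_inv_iff_mul_eq₀ hkl0, hkl]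
    push_cast [Nat.cast_sub hjl] at hrc hpc ⊢
    linear_combination hpc - hrc

/-- A sum-free subset of `ZMod p` of the maximum size is an arithmetic progression. -/
lemma exists_eq_image_of_KLFree {k l m lam p : ℕ} [Fact p.Prime] (hlk : l < k) (hl : 1 ≤ l)
    (hm : 1 ≤ m) (hlam : lam ≤ k + l - 3) (hp : p = (k + l) * m + 2 + lam)
    {B : Finset (ZMod p)} (hfree : KLFree k l (B : Set (ZMod p))) (hcard : B.card = m + 1) :
    ∃ a d : ZMod p, d ≠ 0 ∧ B = (Finset.range (m + 1)).image fun j : ℕ => a + j * d := by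
  rw [← hcard]
  by_contra hAP
  have hgrow (X : Finset (ZMod p)) (hX : 2 ≤ X.card)
      (hXB : (X + B).card + 2 ≤ Fintype.card (ZMod p)) : X.card + B.card ≤ (X + B).card := by
    by_contra! hlt
    rw [ZMod.card] at hXB
    exact hAP (exists_eq_image_of_card_add_lt (by omega) hX hXB hlt)
  have h := hfree.card_le (by omega) hl (Finset.card_pos.1 (by omega)) (by omega) hgrow
  rw [ZMod.card, ← add_mul, hcard, show 2 + (k + l - 2) = k + l by omega, mul_add] at h
  omega

/-- If a dilation by `c` maps an interval onto another one, then `c = ±1`. -/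
lemma eq_one_or_neg_one_of_image_Ival {p m : ℕ} [Fact p.Prime] (hm : 1 ≤ m) (hmp : m + 3 ≤ p)
    {a b c : ZMod p} (h : (fun x => c * x) '' Ival a m = Ival b m) : c = 1 ∨ c = -1 := by
  have htop (x : ZMod p) (hx : x ∈ Ival a m) (hx1 : x + 1 ∉ Ival a m) : x = a + m := by
    obtain ⟨i, hi, rfl⟩ := hx
    obtain rfl | hlt := hi.eq_or_lt
    · rfl
    · exact absurd ⟨i + 1, hlt, by push_cast; ring⟩ hx1
  have hmem (i : ℕ) (hi : i < p) : b + i ∈ Ival b m ↔ i ≤ m := by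
    refine ⟨fun ⟨j, hj, hij⟩ => ?_, fun h => ⟨i, h, rfl⟩⟩
    have h1 := add_left_cancel hij
    rw [ZMod.natCast_eq_natCast_iff', Nat.mod_eq_of_lt hi, Nat.mod_eq_of_lt (by omega)] at h1
    omega
  have hpos := (Fact.out : p.Prime).pos
  have hc0 : c ≠ 0 := by
    rintro rfl
    have h0 : b + (0 : ℕ) ∈ Ival b m := (hmem 0 hpos).2 (Nat.zero_le _)
    have h1 : b + (1 : ℕ) ∈ Ival b m := (hmem 1 (by omega)).2 hm
    rw [← h] at h0 h1
    obtain ⟨_, _, h0⟩ := h0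
    obtain ⟨_, _, h1⟩ := h1
    simp only [zero_mul] at h0 h1
    rw [h0] at h1
    simp at h1
  have htop' (y : ZMod p) (hy : y ∈ Ival b m) (hy1 : y + c ∉ Ival b m) : y = c * (a + m) := by
    rw [← h] at hy hy1
    obtain ⟨x, hx, rfl⟩ := hy
    rw [← htop x hx fun hx1 => hy1 ⟨x + 1, hx1, by ring⟩]
  set r := c.val with hr
  have hrc : (r : ZMod p) = c := ZMod.natCast_zmod_val c
  have hrp : r < p := ZMod.val_lt c
  have hr0 : r ≠ 0 := by
    intro h0
    rw [h0, Nat.cast_zero] at hrc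
    exact hc0 hrc.symm
  have hout (i : ℕ) (hi : i ≤ m) (hir : i + r < p) (hmr : m < i + r) :
      b + i = c * (a + m) := by
    refine htop' _ ((hmem i (by omega)).2 hi) ?_
    rw [← hrc, add_assoc, ← Nat.cast_add, hmem _ hir]
    omega
  have hcontra (i : ℕ) (hi : i + 1 ≤ m) (hir : i + 1 + r < p) (hmr : m < i + r) : False := by
    have h1 := hout i (by omega) (by omega) hmr
    have h2 := hout (i + 1) hi hir (by omega)
    rw [← h1] at h2
    simp at h2
  by_contra! hne
  have hr1 : r ≠ 1 := by
    intro h1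
    rw [h1, Nat.cast_one] at hrc
    exact hne.1 hrc.symm
  have hr2 : r ≠ p - 1 := by
    intro h1
    rw [h1, Nat.cast_sub hpos, ZMod.natCast_self] at hrc
    exact hne.2 (by rw [← hrc]; simp)
  rcases lt_or_ge (m + r) p with hlt | hge
  · exact hcontra (m - 1) (by omega) (by omega) (by omega)
  · exact hcontra (p - 2 - r) (by omega) (by omega) (by omega)

lemma Ival_injective {p m : ℕ} [Fact p.Prime] (hmp : m + 3 ≤ p)
    {a b : ZMod p} (h : Ival a m = Ival b m) : a = b := by
  have hout : b + m + 1 ∉ Ival b m := by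
    rintro ⟨j, hj, hij⟩
    have h1 : ((m + 1 : ℕ) : ZMod p) = j := by
      push_cast
      linear_combination hij
    rw [ZMod.natCast_eq_natCast_iff', Nat.mod_eq_of_lt (by omega),
      Nat.mod_eq_of_lt (by omega)] at h1
    omega
  have hb : b + m ∈ Ival a m := h ▸ ⟨m, le_rfl, rfl⟩
  rw [← h] at hout
  obtain ⟨i, hi, hbi⟩ := hb
  obtain rfl | hlt := hi.eq_or_lt
  · exact (add_right_cancel hbi).symm
  · exact absurd ⟨i + 1, hlt, by rw [hbi]; push_cast; ring⟩ hout

/-- An isomorphism between two cuboids induces a dilation between the base intervals. -/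
lemma exists_image_Ival_of_image_cub {p n m : ℕ} [Fact p.Prime] (hmp : m + 1 < p) {a b : ZMod p}
    (e : (ZMod p × (Fin n → ZMod p)) ≃+ (ZMod p × (Fin n → ZMod p)))
    (he : e '' cub p n a m = cub p n b m) :
    ∃ c : ZMod p, (fun x => c * x) '' Ival a m = Ival b m := by
  have hvert (w : Fin n → ZMod p) : (e (0, w)).1 = 0 := by
    by_contra hu
    let I : Finset (ZMod p) := (Finset.range (m + 1)).image fun i : ℕ => b + i
    have hI (x : ZMod p) : x ∈ I ↔ x ∈ Ival b m := by
      simp only [I, Finset.mem_image, Finset.mem_range, Nat.lt_succ_iff, Ival, Set.mem_ofPred_eq,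
        eq_comm (a := x)]
    have hIcard : I.card < p :=
      (Finset.card_image_le.trans_eq (Finset.card_range _)).trans_lt hmp
    have hI0 : I.Nonempty := ⟨b, (hI b).2 ⟨0, Nat.zero_le _, by simp⟩⟩
    refine vadd_finset_ne_self hI0 hIcard hu
      (Finset.eq_of_subset_of_card_le ?_ (Finset.card_vadd_finset _ _).ge)
    intro z hz
    obtain ⟨y, hy, rfl⟩ := Finset.mem_vadd_finset.1 hz
    rw [hI] at hy ⊢
    have hy' : ((y, 0) : ZMod p × (Fin n → ZMod p)) ∈ cub p n b m := hy
    rw [← he] at hy'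
    obtain ⟨v, hv, hvy⟩ := hy'
    have hv' : e ((0, w) + v) ∈ cub p n b m := by
      rw [← he]
      refine ⟨_, ?_, rfl⟩
      change (0 : ZMod p) + v.1 ∈ Ival a m
      rw [zero_add]
      exact hv
    rw [map_add, hvy] at hv'
    exact hv'
  have hfst (v : ZMod p × (Fin n → ZMod p)) : (e v).1 = (e (1, 0)).1 * v.1 := by
    have hv : v = v.1.val • ((1, 0) : ZMod p × (Fin n → ZMod p)) + (0, v.2) := by
      ext <;> simp
    conv_lhs => rw [hv]
    rw [map_add, map_nsmul, Prod.fst_add, hvert, add_zero, Prod.smul_fst, nsmul_eq_mul,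
      ZMod.natCast_zmod_val, mul_comm]
  refine ⟨(e (1, 0)).1, ?_⟩
  ext y
  constructor
  · rintro ⟨x, hx, rfl⟩
    have : e (x, 0) ∈ cub p n b m := he ▸ ⟨(x, 0), hx, rfl⟩
    change (e (1, 0)).1 * x ∈ Ival b m
    rw [← hfst (x, 0)]
    exact this
  · intro hy
    have hy' : ((y, 0) : ZMod p × (Fin n → ZMod p)) ∈ cub p n b m := hy
    rw [← he] at hy'
    obtain ⟨v, hv, hvy⟩ := hy'
    refine ⟨v.1, hv, ?_⟩
    simp only
    rw [← hfst v, hvy]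

/-- Distinct extremal cuboids are not isomorphic. -/
theorem not_exists_image_cub_eq {k l n m lam p j j' : ℕ} [Fact p.Prime] (hlk : l < k)
    (hkp : k < p) (hm : 1 ≤ m) (hmp : m + 3 ≤ p) (hp : p = (k + l) * m + 2 + lam)
    (hj : j < (lam + 2) / 2) (hj' : j' < (lam + 2) / 2) (hne : j ≠ j') :
    ¬∃ e : (ZMod p × (Fin n → ZMod p)) ≃+ (ZMod p × (Fin n → ZMod p)),
      e '' cub p n (ajElt k l m p j) m = cub p n (ajElt k l m p j') m := by
  rintro ⟨e, he⟩
  have hkl0 := cast_sub_ne_zero hlk hkp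
  have hkl : ((k - l : ℕ) : ZMod p) = k - l := Nat.cast_sub hlk.le
  have haj (i : ℕ) : ajElt k l m p i * ((k - l : ℕ) : ZMod p) = -((k * m + 1 + i : ℕ) : ZMod p) :=
    inv_mul_cancel_right₀ hkl0 _
  have h1 := haj j
  have h2 := haj j'
  rw [hkl] at h1 h2
  have hpc : (((k + l) * m + 2 + lam : ℕ) : ZMod p) = 0 := by rw [← hp, ZMod.natCast_self]
  obtain ⟨c, hc⟩ := exists_image_Ival_of_image_cub (by omega) e he
  rcases eq_one_or_neg_one_of_image_Ival hm hmp hc with rfl | rfl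
  · simp only [one_mul, Set.image_id'] at hc
    have heq := Ival_injective hmp hc
    have hjj : (j : ZMod p) = j' := by
      push_cast at h1 h2
      rw [heq] at h1
      linear_combination h1 - h2
    rw [ZMod.natCast_eq_natCast_iff', Nat.mod_eq_of_lt (by omega),
      Nat.mod_eq_of_lt (by omega)] at hjj
    exact hne hjj
  · simp only [neg_one_mul] at hc
    rw [neg_Ival] at hc
    have heq := Ival_injective hmp hc
    have hjj : ((j + j' : ℕ) : ZMod p) = lam := by
      push_cast at h1 h2 hpc ⊢
      linear_combination h1 + h2 + ((k : ZMod p) - l) * heq - hpc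
    rw [ZMod.natCast_eq_natCast_iff', Nat.mod_eq_of_lt (by omega),
      Nat.mod_eq_of_lt (by omega)] at hjj
    omega

/-- A `(k,ℓ)`-sum-free subset of `F_p^n` of the maximum size
`(m+1)·p^(n-1)` is, up to an additive isomorphism, one of the extremal cuboids
`A_{k,ℓ,p,j} = [a_j, a_j+m] × F_p^(n-1)` with `j < ⌈(λ+1)/2⌉`; moreover distinct
extremal cuboids are non-isomorphic. -/
theorem stmt1 (k l n m lam p : ℕ) (hlk : l < k) (hl : 1 ≤ l) (hn : 1 ≤ n) (hm : 1 ≤ m)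
    (hlam : lam ≤ k + l - 3) (hp : p = (k + l) * m + 2 + lam) (hpp : p.Prime)
    (A : Set (Fin n → ZMod p)) (hfree : KLFree k l A)
    (hcard : A.ncard = (m + 1) * p ^ (n - 1)) :
    (∃ (e : (Fin n → ZMod p) ≃+ (ZMod p × (Fin (n - 1) → ZMod p))) (j : ℕ),
        j < (lam + 2) / 2 ∧ e '' A = cub p (n - 1) (ajElt k l m p j) m) ∧
      ∀ j j' : ℕ, j < (lam + 2) / 2 → j' < (lam + 2) / 2 → j ≠ j' →
        ¬∃ e : (ZMod p × (Fin (n - 1) → ZMod p)) ≃+ (ZMod p × (Fin (n - 1) → ZMod p)),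
            e '' cub p (n - 1) (ajElt k l m p j) m = cub p (n - 1) (ajElt k l m p j') m := by
  have : Fact p.Prime := ⟨hpp⟩
  have hklm : k + l ≤ (k + l) * m := Nat.le_mul_of_pos_right _ hm
  have hkp : k < p := by omega
  have hmp : m + 3 ≤ p := by nlinarith
  refine ⟨?_, fun j j' hj hj' hne => not_exists_image_cub_eq hlk hkp hm hmp hp hj hj' hne⟩
  obtain ⟨f, B, hf, hAB⟩ := exists_functional_eq_preimage hlk hl hlam hp hm (n - 1)
    (V := Fin n → ZMod p) (by rw [Module.finrank_fin_fun]; omega) hfree hcard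
  obtain ⟨e, he⟩ := exists_linearEquiv_fst_eq hn f hf
  have himg : e '' A = {x | x.1 ∈ B} := by
    ext x
    obtain ⟨v, rfl⟩ := e.surjective x
    rw [e.injective.mem_set_image, hAB, Set.mem_preimage, Set.mem_ofPred_eq, he]
  have hBcard : B.ncard = m + 1 := by
    have h := Set.ncard_image_of_injective A e.injective
    rw [himg, ncard_cub, hcard] at h
    exact Nat.eq_of_mul_eq_mul_right (pow_pos hpp.pos _) h
  have hfA : f '' A = B := by rw [hAB, Set.image_preimage_eq _ hf]
  have hfreeB : KLFree k l B := by
    have h := hfree.image hl f.toAddMonoidHom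
    have hcoe : ⇑f.toAddMonoidHom = f := rfl
    rw [hcoe, hfA] at h
    exact h hAB.ge
  lift B to Finset (ZMod p) using B.toFinite
  rw [Set.ncard_coe_finset] at hBcard
  obtain ⟨a, d, hd, hB⟩ := exists_eq_image_of_KLFree hlk hl hm hlam hp hfreeB hBcard
  have hscale (s : ZMod p) : (fun x => s * d⁻¹ * x) '' (B : Set (ZMod p)) =
      (fun x => s * x) '' Ival (d⁻¹ * a) m := by
    rw [hB]
    have hi (i : ℕ) : s * d⁻¹ * (a + i * d) = s * (d⁻¹ * a + i) := by field_simp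
    ext x
    simp only [Finset.coe_image, Finset.coe_range, Set.image_image, hi]
    constructor
    · rintro ⟨i, hi, rfl⟩
      exact ⟨_, ⟨i, Nat.lt_succ_iff.1 hi, rfl⟩, rfl⟩
    · rintro ⟨_, ⟨i, hi, rfl⟩, rfl⟩
      exact ⟨i, Nat.lt_succ_iff.2 hi, rfl⟩
  have hfreeI : KLFree k l (Ival (d⁻¹ * a) m) := by
    have h1 := hscale 1
    simp only [one_mul, Set.image_id'] at h1
    have h := hfreeB.image hl (AddMonoidHom.mulLeft d⁻¹)
      (Set.preimage_image_eq _ (mul_right_injective₀ (inv_ne_zero hd))).le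
    rw [← h1]
    exact h
  obtain ⟨j, hj, hja⟩ := exists_eq_ajElt_of_KLFree_Ival hlk hkp hp hfreeI
  obtain ⟨s, hs, hsI⟩ : ∃ s : ZMod p, s ≠ 0 ∧
      (fun x => s * d⁻¹ * x) '' (B : Set (ZMod p)) = Ival (ajElt k l m p j) m := by
    rcases hja with h | h
    · refine ⟨1, one_ne_zero, ?_⟩
      rw [hscale, ← h]
      simp
    · refine ⟨-1, neg_ne_zero.2 one_ne_zero, ?_⟩
      rw [hscale, ← h, ← neg_Ival]
      simp
  have hsd : s * d⁻¹ ≠ 0 := mul_ne_zero hs (inv_ne_zero hd)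
  let g : (ZMod p × (Fin (n - 1) → ZMod p)) ≃ₗ[ZMod p] (ZMod p × (Fin (n - 1) → ZMod p)) :=
    (LinearEquiv.smulOfNeZero (ZMod p) (ZMod p) _ hsd).prodCongr (LinearEquiv.refl _ _)
  refine ⟨(e.trans g).toAddEquiv, j, hj, ?_⟩
  have hcomp : ⇑(e.trans g).toAddEquiv = g ∘ e := rfl
  rw [hcomp, Set.image_comp, himg]
  ext x
  obtain ⟨v, rfl⟩ := g.surjective x
  rw [g.injective.mem_set_image]
  change v.1 ∈ (B : Set (ZMod p)) ↔ s * d⁻¹ * v.1 ∈ Ival (ajElt k l m p j) m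
  rw [← hsI]
  exact ((mul_right_injective₀ hsd).mem_set_image (s := (B : Set (ZMod p)))).symm
end
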